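/- For every real β with 0 < β ≤ 1 and every T > 0, the second normalized Steklov eigenvalue satisfies σ̃_2(β,T) = λ̃_1(β,T) < 4π; moreover, sup over all β ∈ (0,1] and T > 0 of σ̃_2(β,T) equals 4π, and this supremum is not attained. -/

import Mathlib

open Real

/-- The hyperbolic cotangent. -/
noncomputable def coth (t : ℝ) : ℝ := Real.cosh t / Real.sinh t

/-- The normalized Steklov eigenvalues `λ̃_n(β,T)` (for `n ≥ 1`). -/
noncomputable def lamS (n : ℕ) (β T : ℝ) : ℝ :=
  (4 * n * π / β) * (coth (n * T) - Real.sqrt ((coth (n * T)) ^ 2 - β))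

/-- The normalized Steklov eigenvalues `μ̃_n(β,T)` (with `μ̃_0(β,T) = 8π/(Tβ)`). -/
noncomputable def muS (n : ℕ) (β T : ℝ) : ℝ :=
  if n = 0 then 8 * π / (T * β)
  else (4 * n * π / β) * (coth (n * T) + Real.sqrt ((coth (n * T)) ^ 2 - β))

/-- The `j`-th smallest normalized Steklov eigenvalue, counted with multiplicity:
`μ̃_0` has multiplicity one, and each `λ̃_n`, `μ̃_n` (`n ≥ 1`) has multiplicity two. -/
noncomputable def sigmaS (β T : ℝ) (j : ℕ) : ℝ :=
  sInf { x : ℝ |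
    j ≤ 2 * {n : ℕ | 1 ≤ n ∧ lamS n β T ≤ x}.ncard
      + 2 * {n : ℕ | 1 ≤ n ∧ muS n β T ≤ x}.ncard
      + (if muS 0 β T ≤ x then 1 else 0) }

lemma one_lt_coth {t : ℝ} (ht : 0 < t) : 1 < coth t := by
  rw [coth, one_lt_div (Real.sinh_pos_iff.mpr ht)]
  exact Real.sinh_lt_cosh t

lemma coth_le_coth {s t : ℝ} (hs : 0 < s) (hst : s ≤ t) : coth t ≤ coth s := by
  have ht : 0 < t := hs.trans_le hst
  rw [coth, coth, div_le_div_iff₀ (Real.sinh_pos_iff.mpr ht) (Real.sinh_pos_iff.mpr hs)]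
  have h : 0 ≤ Real.sinh (t - s) := Real.sinh_nonneg_iff.mpr (by linarith)
  rw [Real.sinh_sub] at h
  linarith

lemma lamS_eq {n : ℕ} {β T : ℝ} (hn : 1 ≤ n) (hβ : 0 < β) (hβ1 : β ≤ 1) (hT : 0 < T) :
    lamS n β T = 4 * n * π / (coth (n * T) + √(coth (n * T) ^ 2 - β)) := by
  have hn' : (0 : ℝ) < n := by exact_mod_cast hn
  have hc := one_lt_coth (mul_pos hn' hT)
  have hs := Real.sq_sqrt (show 0 ≤ coth (n * T) ^ 2 - β by nlinarith)
  have hs0 := Real.sqrt_nonneg (coth (n * T) ^ 2 - β)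
  have hd : coth (n * T) + √(coth (n * T) ^ 2 - β) ≠ 0 := by positivity
  rw [lamS, eq_div_iff hd, div_mul_eq_mul_div, div_mul_eq_mul_div, div_eq_iff hβ.ne']
  linear_combination (-4 * n * π) * hs

lemma lamS_le_muS {n : ℕ} {β T : ℝ} (hn : 1 ≤ n) (hβ : 0 < β) : lamS n β T ≤ muS n β T := by
  rw [lamS, muS, if_neg (by omega)]
  have hs0 := Real.sqrt_nonneg (coth (n * T) ^ 2 - β)
  gcongr
  linarith

lemma mul_lamS_one_le {n : ℕ} {β T : ℝ} (hn : 1 ≤ n) (hβ : 0 < β) (hβ1 : β ≤ 1) (hT : 0 < T) :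
    n * lamS 1 β T ≤ lamS n β T := by
  have hn' : (1 : ℝ) ≤ n := by exact_mod_cast hn
  have hnT : T ≤ n * T := le_mul_of_one_le_left hT.le hn'
  have hle := coth_le_coth hT hnT
  have hc := one_lt_coth (hT.trans_le hnT)
  rw [lamS_eq hn hβ hβ1 hT, lamS_eq le_rfl hβ hβ1 hT, Nat.cast_one, one_mul, mul_one,
    ← mul_div_assoc, show (n : ℝ) * (4 * π) = 4 * n * π by ring]
  gcongr

lemma lamS_one_pos {β T : ℝ} (hβ : 0 < β) (hβ1 : β ≤ 1) (hT : 0 < T) : 0 < lamS 1 β T := by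
  have hc := one_lt_coth hT
  rw [lamS_eq le_rfl hβ hβ1 hT, Nat.cast_one, one_mul]
  positivity

lemma lamS_one_lt {β T : ℝ} (hβ : 0 < β) (hβ1 : β ≤ 1) (hT : 0 < T) :
    lamS 1 β T < 4 * π := by
  have hc := one_lt_coth hT
  have hs0 := Real.sqrt_nonneg (coth T ^ 2 - β)
  rw [lamS_eq le_rfl hβ hβ1 hT, Nat.cast_one, one_mul, mul_one]
  exact div_lt_self (by positivity) (by linarith)

lemma lamS_one_le_lamS {n : ℕ} {β T : ℝ} (hn : 1 ≤ n) (hβ : 0 < β) (hβ1 : β ≤ 1)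
    (hT : 0 < T) : lamS 1 β T ≤ lamS n β T :=
  (le_mul_of_one_le_left (lamS_one_pos hβ hβ1 hT).le (by exact_mod_cast hn)).trans
    (mul_lamS_one_le hn hβ hβ1 hT)

lemma finite_setOf_lamS_le {β T : ℝ} (hβ : 0 < β) (hβ1 : β ≤ 1) (hT : 0 < T) (x : ℝ) :
    {n : ℕ | 1 ≤ n ∧ lamS n β T ≤ x}.Finite := by
  refine (Set.finite_Iic ⌊x / lamS 1 β T⌋₊).subset fun n ⟨hn, hx⟩ => Nat.le_floor ?_
  rw [le_div_iff₀ (lamS_one_pos hβ hβ1 hT)]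
  exact (mul_lamS_one_le hn hβ hβ1 hT).trans hx

lemma sigmaS_two {β T : ℝ} (hβ : 0 < β) (hβ1 : β ≤ 1) (hT : 0 < T) :
    sigmaS β T 2 = lamS 1 β T := by
  refine IsLeast.csInf_eq ⟨?_, fun x hx => ?_⟩
  · have h : 0 < {n : ℕ | 1 ≤ n ∧ lamS n β T ≤ lamS 1 β T}.ncard :=
      (Set.ncard_pos (finite_setOf_lamS_le hβ hβ1 hT _)).mpr ⟨1, le_rfl, le_rfl⟩
    rw [Set.mem_ofPred_eq]
    omega
  · by_contra! hlt
    have hlam : {n : ℕ | 1 ≤ n ∧ lamS n β T ≤ x} = ∅ :=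
      Set.eq_empty_of_forall_notMem fun n ⟨hn, hx⟩ =>
        (hlt.trans_le (lamS_one_le_lamS hn hβ hβ1 hT)).not_ge hx
    have hmu : {n : ℕ | 1 ≤ n ∧ muS n β T ≤ x} = ∅ :=
      Set.eq_empty_of_forall_notMem fun n ⟨hn, hx⟩ =>
        (hlt.trans_le ((lamS_one_le_lamS hn hβ hβ1 hT).trans (lamS_le_muS hn hβ))).not_ge hx
    rw [Set.mem_ofPred_eq, hlam, hmu, Set.ncard_empty] at hx
    split_ifs at hx <;> omega

lemma lamS_one_one {T : ℝ} (hT : 0 < T) :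
    lamS 1 1 T = 4 * π * ((Real.cosh T - 1) / Real.sinh T) := by
  have hs : 0 < Real.sinh T := Real.sinh_pos_iff.mpr hT
  have h : coth T ^ 2 - 1 = (1 / Real.sinh T) ^ 2 := by
    rw [coth, div_pow, Real.cosh_sq]
    field_simp
    ring
  rw [lamS, Nat.cast_one, one_mul, h, Real.sqrt_sq (by positivity), coth]
  ring

lemma exists_lt_lamS_one {w : ℝ} (hw : w < 4 * π) : ∃ T : ℝ, 0 < T ∧ w < lamS 1 1 T := by
  have hd : 0 < 4 * π - w := sub_pos.mpr hw
  obtain ⟨s, hs⟩ := exists_gt (4 * π / (4 * π - w))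
  have hs0 : 0 < s := lt_trans (by positivity) hs
  have hT : 0 < Real.arsinh s := Real.arsinh_pos_iff.mpr hs0
  refine ⟨Real.arsinh s, hT, ?_⟩
  have hc := Real.sinh_lt_cosh (Real.arsinh s)
  rw [lamS_one_one hT]
  rw [Real.sinh_arsinh] at hc ⊢
  rw [div_lt_iff₀ hd] at hs
  rw [← mul_div_assoc, lt_div_iff₀ hs0]
  nlinarith [Real.pi_pos]

theorem second_eigenvalue_sup_not_attained :
    (∀ β T : ℝ, 0 < β → β ≤ 1 → 0 < T →
      sigmaS β T 2 = lamS 1 β T ∧ sigmaS β T 2 < 4 * π) ∧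
    sSup { x : ℝ | ∃ β T : ℝ, 0 < β ∧ β ≤ 1 ∧ 0 < T ∧ x = sigmaS β T 2 } = 4 * π ∧
    ¬ ∃ β T : ℝ, 0 < β ∧ β ≤ 1 ∧ 0 < T ∧ sigmaS β T 2 = 4 * π := by
  refine ⟨fun β T hβ hβ1 hT => ⟨sigmaS_two hβ hβ1 hT, ?_⟩, ?_, ?_⟩
  · rw [sigmaS_two hβ hβ1 hT]
    exact lamS_one_lt hβ hβ1 hT
  · refine csSup_eq_of_forall_le_of_forall_lt_exists_gt
      ⟨_, 1, 1, one_pos, le_rfl, one_pos, rfl⟩ ?_ fun w hw => ?_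
    · rintro x ⟨β, T, hβ, hβ1, hT, rfl⟩
      rw [sigmaS_two hβ hβ1 hT]
      exact (lamS_one_lt hβ hβ1 hT).le
    · obtain ⟨T, hT, hlt⟩ := exists_lt_lamS_one hw
      exact ⟨_, ⟨1, T, one_pos, le_rfl, hT, rfl⟩, by rwa [sigmaS_two one_pos le_rfl hT]⟩
  · rintro ⟨β, T, hβ, hβ1, hT, h⟩
    rw [sigmaS_two hβ hβ1 hT] at h
    exact (lamS_one_lt hβ hβ1 hT).ne h
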